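/- Let G be a finite group and T an abelian normal subgroup of G. Suppose π : Γ_K → G is a continuous homomorphism whose image satisfies π(Γ_K)·T = G. Then there exists a continuous surjective homomorphism π′ : Γ_K → G such that π′(x)T = π(x)T for all x ∈ Γ_K. -/

import Mathlib

open scoped IsMulCommutative
open NumberField IsDedekindDomain WithZero

/-- For a nonzero algebraic integer `β`, some `1 + k β` with `k` an integer is not a unit. -/
theorem NumberField.exists_not_isUnit_one_add_mul {L : Type*} [Field L] [NumberField L]
    {β : 𝓞 L} (hβ : β ≠ 0) : ∃ k : ℕ, ¬ IsUnit (1 + (k : 𝓞 L) * β) := by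
  have hpos (w : InfinitePlace L) : 0 < w (β : L) :=
    InfinitePlace.pos_iff.mpr (RingOfIntegers.coe_ne_zero_iff.mpr hβ)
  choose f hf using fun w : InfinitePlace L ↦ exists_nat_gt (2 / w (β : L))
  have hk (w : InfinitePlace L) : 2 < (∑ w, f w : ℕ) * w (β : L) := by
    have h1 : f w ≤ ∑ w, f w := Finset.single_le_sum (fun _ _ ↦ Nat.zero_le _) (Finset.mem_univ w)
    have h2 : (f w : ℝ) ≤ (∑ w, f w : ℕ) := by exact_mod_cast h1
    rw [← div_lt_iff₀ (hpos w)]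
    exact (hf w).trans_le h2
  generalize (∑ w, f w : ℕ) = k at hk
  refine ⟨k, fun hu ↦ ?_⟩
  rw [NumberField.isUnit_iff_norm, RingOfIntegers.coe_norm] at hu
  have hprod := InfinitePlace.prod_eq_abs_norm (1 + (k : L) * (β : L))
  have hlt (w : InfinitePlace L) : 1 < w (1 + (k : L) * (β : L)) := by
    have h1 : w ((k : L) * (β : L)) ≤ w (1 + (k : L) * (β : L)) + w (-1) := by
      have := w.1.add_le (1 + (k : L) * (β : L)) (-1)
      rwa [add_neg_cancel_comm] at this
    have h2 : w ((k : L) * (β : L)) = k * w (β : L) := by simp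
    have h3 : w (-1 : L) = 1 := (w.1.map_neg 1).trans w.1.map_one
    linarith [hk w]
  have h1 : (1 : ℝ) < ∏ w : InfinitePlace L, w (1 + (k : L) * (β : L)) ^ w.mult := by
    obtain ⟨w₀⟩ : Nonempty (InfinitePlace L) := inferInstance
    calc (1 : ℝ) = ∏ w : InfinitePlace L, 1 := by simp
      _ < _ := Finset.prod_lt_prod_of_nonempty (by simp)
        (fun w _ ↦ one_lt_pow₀ (hlt w) InfinitePlace.mult_ne_zero) ⟨w₀, Finset.mem_univ _⟩
  rw [hprod] at h1
  have h2 : ((1 + (k : 𝓞 L) * β : 𝓞 L) : L) = 1 + (k : L) * (β : L) := by simp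
  rw [h2] at hu
  rw [hu] at h1
  norm_num at h1

/-- A number field contains a nonzero algebraic integer with trivial stabilizer. -/
theorem NumberField.exists_integer_trivial_stabilizer (K L : Type*) [Field K] [Field L]
    [NumberField L] [Algebra K L] :
    ∃ θ : 𝓞 L, θ ≠ 0 ∧ ∀ σ : L ≃ₐ[K] L, σ (θ : L) = θ → σ = 1 := by
  obtain ⟨x, hx⟩ := Field.exists_primitive_element ℚ L
  obtain ⟨d, hd, hdx⟩ := ((IsFractionRing.isAlgebraic_iff ℤ ℚ L).mpr
    (Algebra.IsAlgebraic.isAlgebraic x)).exists_integral_multiple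
  have hstab (σ : L ≃ₐ[K] L) (h : σ (d • x) = d • x) : σ = 1 := by
    have hσx : σ x = x := by
      rw [map_zsmul] at h
      exact smul_right_injective L hd h
    have hQ : ((σ : L →+* L).toRatAlgHom) = AlgHom.id ℚ L := by
      refine AlgHom.ext_of_adjoin_eq_top
        ((IntermediateField.adjoin_eq_top_iff_of_isAlgebraic
          fun y _ ↦ Algebra.IsAlgebraic.isAlgebraic y).mp hx) ?_
      simpa using hσx
    ext y
    exact congr($hQ y)
  by_cases h0 : d • x = 0
  · refine ⟨1, one_ne_zero, fun σ _ ↦ hstab σ ?_⟩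
    rw [h0, map_zero]
  · refine ⟨⟨d • x, hdx⟩, fun h ↦ h0 (congrArg (fun z : 𝓞 L ↦ (z : L)) h), hstab⟩

theorem NumberField.exists_valuation_eq_exp_neg_one (K L : Type*) [Field K] [Field L]
    [NumberField L] [Algebra K L] [FiniteDimensional K L] :
    ∃ (v : HeightOneSpectrum (𝓞 L)) (a : L), v.valuation L a = exp (-1 : ℤ) ∧
      ∀ σ : L ≃ₐ[K] L, σ ≠ 1 → v.valuation L (σ a) = 1 := by
  classical
  obtain ⟨θ, hθ, hstab⟩ := NumberField.exists_integer_trivial_stabilizer K L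
  let r (σ : L ≃ₐ[K] L) : 𝓞 L ≃+* 𝓞 L := RingOfIntegers.mapRingEquiv σ.toRingEquiv
  have hr (σ : L ≃ₐ[K] L) (x : 𝓞 L) : ((r σ x : 𝓞 L) : L) = σ (x : L) := rfl
  have hdiff (σ : L ≃ₐ[K] L) (hσ : σ ≠ 1) : r σ θ - θ ≠ 0 := fun h ↦
    hσ (hstab σ (by rw [← hr, sub_eq_zero.mp h]))
  set D : 𝓞 L := ∏ σ ∈ Finset.univ.filter (fun σ : L ≃ₐ[K] L ↦ σ ≠ 1), (r σ θ - θ) with hD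
  have hD0 : D ≠ 0 := Finset.prod_ne_zero_iff.mpr fun σ hσ ↦ hdiff σ (by simpa using hσ)
  set M : ℕ := Ideal.absNorm (Ideal.span {D})
  have hM0 : (M : 𝓞 L) ≠ 0 := by
    rw [Nat.cast_ne_zero]
    simpa [M, Ideal.absNorm_eq_zero_iff] using hD0
  have hDM : D ∣ (M : 𝓞 L) := Ideal.mem_span_singleton.mp (Ideal.absNorm_mem _)
  obtain ⟨k, hk⟩ := NumberField.exists_not_isUnit_one_add_mul (mul_ne_zero hM0 hθ)
  obtain ⟨P, hPmax, hαP⟩ := exists_max_ideal_of_mem_nonunits hk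
  set α : 𝓞 L := 1 + (k : 𝓞 L) * (M * θ) with hα
  have hcop {x : 𝓞 L} (hx : x ∣ (k : 𝓞 L) * (M * θ)) : x ∉ P := fun h ↦ by
    obtain ⟨y, hy⟩ := hx
    refine hPmax.ne_top ((Ideal.eq_top_iff_one P).mpr ?_)
    have : (1 : 𝓞 L) = α - x * y := by rw [hα, hy]; ring
    rw [this]
    exact P.sub_mem hαP (P.mul_mem_right _ h)
  have hP0 : P ≠ ⊥ := Ring.ne_bot_of_isMaximal_of_not_isField hPmax (RingOfIntegers.not_isField L)
  have hnot (σ : L ≃ₐ[K] L) (hσ : σ ≠ 1) : r σ α ∉ P := fun h ↦ by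
    have h1 : r σ α - α ∈ P := P.sub_mem h hαP
    have h2 : r σ α - α = k * M * (r σ θ - θ) := by
      simp only [hα, map_add, map_mul, map_natCast, map_one]; ring
    have hdvd : (r σ θ - θ) ∣ D := Finset.dvd_prod_of_mem _ (by simpa using hσ)
    rw [h2] at h1
    rcases hPmax.isPrime.mem_or_mem h1 with h1 | h1
    · exact hcop ⟨θ, by ring⟩ h1
    · exact hcop (hdvd.trans (hDM.trans ⟨k * θ, by ring⟩)) h1
  let v : HeightOneSpectrum (𝓞 L) := ⟨P, hPmax.isPrime, hP0⟩
  have hvα : v.valuation L (α : L) < 1 := (v.valuation_lt_one_iff_mem α).mpr hαP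
  have hvσα (σ : L ≃ₐ[K] L) (hσ : σ ≠ 1) : v.valuation L (σ (α : L)) = 1 :=
    v.valuation_eq_one_iff_notMem.mpr (hnot σ hσ)
  have hle (σ : L ≃ₐ[K] L) (x : 𝓞 L) : v.valuation L (σ (x : L)) ≤ 1 :=
    v.valuation_le_one (r σ x)
  by_cases hα1 : v.valuation L (α : L) = exp (-1 : ℤ)
  · exact ⟨v, α, hα1, hvσα⟩
  obtain ⟨y, hy⟩ := v.intValuation_exists_uniformizer
  have hvy : v.valuation L (y : L) = exp (-1 : ℤ) := by rw [v.valuation_of_algebraMap, hy]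
  set β : 𝓞 L := ∏ σ ∈ Finset.univ.filter (fun σ : L ≃ₐ[K] L ↦ σ ≠ 1), r σ α with hβ
  have hvβ : v.valuation L (β : L) = 1 := by
    refine v.valuation_eq_one_iff_notMem.mpr fun h ↦ ?_
    obtain ⟨σ, hσ, h⟩ := hPmax.isPrime.prod_mem_iff.mp h
    exact hnot σ (by simpa using hσ) h
  have hvσβ (σ : L ≃ₐ[K] L) (hσ : σ ≠ 1) : v.valuation L (σ (β : L)) < 1 := by
    have hdvd : α ∣ r σ β := by
      rw [hβ, map_prod]
      have := Finset.dvd_prod_of_mem (fun τ ↦ r σ (r τ α))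
        (show σ⁻¹ ∈ Finset.univ.filter (fun σ : L ≃ₐ[K] L ↦ σ ≠ 1) by simpa using hσ)
      convert this using 1
      ext
      simp [hr]
    rw [← hr]
    exact (v.valuation_lt_one_iff_mem _).mpr (P.mem_of_dvd hdvd hαP)
  have hα2 : v.valuation L (α : L) < exp (-1 : ℤ) := by
    refine lt_of_le_of_ne ?_ hα1
    rw [v.valuation_of_algebraMap]
    simpa using (v.intValuation_le_pow_iff_mem α 1).mpr (by simpa using hαP)
  refine ⟨v, α + y * β, ?_, fun σ hσ ↦ ?_⟩
  · have hyβ : v.valuation L (y * β : L) = exp (-1 : ℤ) := by rw [map_mul, hvy, hvβ, mul_one]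
    rw [Valuation.map_add_eq_of_lt_right _ (by rwa [hyβ]), hyβ]
  · rw [map_add, Valuation.map_add_eq_of_lt_left, hvσα σ hσ]
    rw [hvσα σ hσ, map_mul, map_mul]
    exact mul_lt_one_of_nonneg_of_lt_one_right (hle σ y) zero_le (hvσβ σ hσ)

theorem NumberField.dvd_of_pow_eq_prod_conj {K L : Type*} [Field K] [Field L]
    [NumberField L] [Algebra K L] [FiniteDimensional K L] {v : HeightOneSpectrum (𝓞 L)} {a : L}
    (ha : v.valuation L a = exp (-1 : ℤ))
    (hσa : ∀ σ : L ≃ₐ[K] L, σ ≠ 1 → v.valuation L (σ a) = 1)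
    {n : ℕ} {m : (L ≃ₐ[K] L) → ℕ} {b : L} (hb : b ^ n = ∏ σ, σ a ^ m σ) : n ∣ m 1 := by
  have h1 : v.valuation L b ^ n = exp (-1 : ℤ) ^ m 1 := by
    rw [← map_pow, hb, map_prod, Finset.prod_eq_single 1]
    · simp [ha]
    · intro σ _ hσ
      simp [hσa σ hσ]
    · simp
  have h2 := congr(log $h1)
  rw [log_pow, log_pow, log_exp] at h2
  have h3 : (m 1 : ℤ) = n * (-log (v.valuation L b)) := by
    simp only [nsmul_eq_mul] at h2
    linarith
  exact Int.natCast_dvd_natCast.mp ⟨_, h3⟩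

theorem pow_zmod_val_add {M : Type*} [Monoid M] {n : ℕ} [NeZero n] {u : M} (hu : u ^ n = 1)
    (a b : ZMod n) : u ^ (a + b).val = u ^ a.val * u ^ b.val := by
  rw [← pow_add, ZMod.val_add, ← pow_eq_pow_mod _ hu]

/-- Twisting a homomorphism `π` by the corestriction to `Γ` of a character of the kernel of
`ρ : Γ → Q` with values in the cyclic group generated by `t`. -/
theorem MonoidHom.exists_twist_of_cocycle {Γ Q G : Type*} [Group Γ] [Group Q] [Finite Q] [Group G]
    {T : Subgroup G} [T.Normal] [IsMulCommutative T] {ρ : Γ →* Q} (hρ : Function.Surjective ρ)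
    {π : Γ →* G} (hπ : ρ.ker ≤ π.ker) {n : ℕ} [NeZero n] {t : G} (ht : t ∈ T) (htn : t ^ n = 1)
    {e : Γ → Q → ZMod n} (he : ∀ g h σ, e (g * h) σ = e g (ρ h * σ) + e h σ)
    {x : Γ} (hx : ρ x = 1) (hx1 : e x 1 = 1) (hxσ : ∀ σ, σ ≠ 1 → e x σ = 0) :
    ∃ π' : Γ →* G, (∀ g, (π g)⁻¹ * π' g ∈ T) ∧ π.range ≤ π'.range ∧ t ∈ π'.range ∧
      ∀ g, ρ g = 1 → (∀ σ, e g σ = 0) → π' g = 1 := by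
  classical
  have := Fintype.ofFinite Q
  obtain ⟨s, hs⟩ := hρ.hasRightInverse
  have hπρ {g h : Γ} (hgh : ρ g = ρ h) : π g = π h := by
    have : g⁻¹ * h ∈ π.ker := hπ (by simp [MonoidHom.mem_ker, hgh])
    rwa [MonoidHom.mem_ker, map_mul, map_inv, inv_mul_eq_one] at this
  let u (τ : Q) : T := ⟨π (s τ) * t * (π (s τ))⁻¹, ‹T.Normal›.conj_mem t ht _⟩
  have hun (τ : Q) : u τ ^ n = 1 := by
    ext
    simp [u, conj_pow, htn]
  have hconj (g : Γ) (τ : Q) : MulAut.conjNormal (π g) (u τ) = u (ρ g * τ) := by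
    ext
    have h : π (s (ρ g * τ)) = π g * π (s τ) := by
      rw [← map_mul]
      exact hπρ (by rw [hs, map_mul, hs])
    simp [u, h, mul_assoc]
  let c (g : Γ) : T := ∏ σ, u (ρ g * σ) ^ (e g σ).val
  have hc (g h : Γ) : c (g * h) = c g * MulAut.conjNormal (π g) (c h) := by
    have h1 : c g = ∏ σ, u (ρ g * (ρ h * σ)) ^ (e g (ρ h * σ)).val :=
      (Equiv.prod_comp (Equiv.mulLeft (ρ h)) (fun σ ↦ u (ρ g * σ) ^ (e g σ).val)).symm
    simp only [h1, c, map_prod, map_pow, hconj, ← Finset.prod_mul_distrib, he, map_mul,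
      mul_assoc, pow_zmod_val_add (hun _)]
  let π' : Γ →* G := MonoidHom.mk' (fun g ↦ c g * π g) fun g h ↦ by
    rw [hc]
    simp [mul_assoc]
  have hπ' (g : Γ) : π' g = c g * π g := rfl
  have hcx : c x = u 1 := by
    simp only [c, hx, one_mul]
    rw [Finset.prod_eq_single 1]
    · rw [hx1]
      rcases eq_or_ne n 1 with rfl | hn
      · have := hun 1
        simp_all
      · have : Fact (1 < n) := ⟨by have := NeZero.ne n; omega⟩
        rw [ZMod.val_one, pow_one]
    · intro σ _ hσ
      rw [hxσ σ hσ, ZMod.val_zero, pow_zero]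
    · simp
  have hu1 : (u 1 : G) = t := by
    have : π (s 1) = 1 := by rw [hπρ (h := 1) (by rw [hs, map_one]), map_one]
    simp [u, this]
  have hπx : π x = 1 := by rw [hπρ (h := 1) (by rw [hx, map_one]), map_one]
  have htr : π' x = t := by rw [hπ', hcx, hu1, hπx, mul_one]
  have hu (τ : Q) : (u τ : G) ∈ π'.range := by
    refine ⟨s τ * x * (s τ)⁻¹, ?_⟩
    have hcomm : (c (s τ) : G) * u τ = u τ * c (s τ) := congrArg Subtype.val (mul_comm (c (s τ)) (u τ))
    rw [map_mul, map_mul, map_inv, htr, hπ', mul_inv_rev]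
    calc (c (s τ) : G) * π (s τ) * t * ((π (s τ))⁻¹ * (c (s τ) : G)⁻¹)
        = (c (s τ) : G) * (u τ : G) * (c (s τ) : G)⁻¹ := by simp [u, mul_assoc]
      _ = u τ := by rw [hcomm, mul_inv_cancel_right]
  have hcr (g : Γ) : (c g : G) ∈ π'.range := by
    have : c g ∈ π'.range.subgroupOf T :=
      Subgroup.prod_mem _ fun σ _ ↦ Subgroup.pow_mem _ (hu _) _
    exact this
  refine ⟨π', fun g ↦ ?_, ?_, ⟨x, htr⟩, fun g hg heg ↦ ?_⟩
  · rw [hπ', ← mul_assoc]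
    simpa using ‹T.Normal›.conj_mem _ (c g).2 (π g)⁻¹
  · rintro _ ⟨g, rfl⟩
    have := π'.range.mul_mem (π'.range.inv_mem (hcr g)) ⟨g, rfl⟩
    rwa [hπ', inv_mul_cancel_left] at this
  · have hcg : c g = 1 := by simp [c, heg]
    rw [hπ', hcg, hπρ (h := 1) (by rw [hg, map_one]), map_one]
    simp

/-- For a finite Galois extension `L / K` of number fields containing a primitive `n`-th root of
unity, there is a cocycle of the absolute Galois group with values in the module induced from the
trivial `Gal(Ω/L)`-module `ZMod n`, whose values on `Gal(Ω/L)` include the generator supported at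
the identity. -/
theorem NumberField.exists_kummer_cocycle {K Ω : Type*} [Field K] [Field Ω] [Algebra K Ω]
    [CharZero Ω] [IsAlgClosed Ω] [IsGalois K Ω] (L : IntermediateField K Ω) [NumberField L]
    [FiniteDimensional K L] [Normal K L] {n : ℕ} [NeZero n] {ζ : L} (hζ : IsPrimitiveRoot ζ n) :
    ∃ e : (Ω ≃ₐ[K] Ω) → (L ≃ₐ[K] L) → ZMod n,
      (∀ g h σ, e (g * h) σ = e g (AlgEquiv.restrictNormalHom L h * σ) + e h σ) ∧
      (∃ x, AlgEquiv.restrictNormalHom L x = 1 ∧ e x 1 = 1 ∧ ∀ σ, σ ≠ 1 → e x σ = 0) ∧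
      ∃ α : (L ≃ₐ[K] L) → Ω, ∀ g, AlgEquiv.restrictNormalHom L g = 1 →
        (∀ σ, g (α σ) = α σ) → ∀ σ, e g σ = 0 := by
  classical
  obtain ⟨v, a, ha, hσa⟩ := NumberField.exists_valuation_eq_exp_neg_one K L
  have ha0 : a ≠ 0 := by
    rintro rfl
    rw [map_zero] at ha
    exact exp_ne_zero ha.symm
  set ρ : (Ω ≃ₐ[K] Ω) →* (L ≃ₐ[K] L) := AlgEquiv.restrictNormalHom L with hρ
  have hρ_apply (g : Ω ≃ₐ[K] Ω) (y : L) : ((ρ g y : L) : Ω) = g y :=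
    AlgEquiv.restrictNormalHom_apply L g y
  choose α hα using fun σ : L ≃ₐ[K] L ↦
    IsAlgClosed.exists_pow_nat_eq ((σ a : L) : Ω) (NeZero.pos n)
  have hα0 (σ : L ≃ₐ[K] L) : α σ ≠ 0 := fun h ↦ by
    have := hα σ
    rw [h, zero_pow (NeZero.ne n), eq_comm, ZeroMemClass.coe_eq_zero] at this
    exact ha0 (by simpa using this)
  let z (σ : L ≃ₐ[K] L) : Ω := (σ ζ : L)
  have hz (σ : L ≃ₐ[K] L) : IsPrimitiveRoot (z σ) n :=
    (hζ.map_of_injective σ.injective).map_of_injective (f := algebraMap L Ω)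
      (algebraMap L Ω).injective
  have hzg (g : Ω ≃ₐ[K] Ω) (σ : L ≃ₐ[K] L) : g (z σ) = z (ρ g * σ) := by
    rw [← hρ_apply]; rfl
  have hex (g : Ω ≃ₐ[K] Ω) (σ : L ≃ₐ[K] L) :
      ∃ i : ZMod n, g (α σ) = z (ρ g * σ) ^ i.val * α (ρ g * σ) := by
    have h1 : (g (α σ) / α (ρ g * σ)) ^ n = 1 := by
      rw [div_pow, ← map_pow, hα, hα, ← hρ_apply, AlgEquiv.mul_apply, div_self]
      rw [← AlgEquiv.mul_apply, ← hα]
      exact pow_ne_zero _ (hα0 _)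
    obtain ⟨i, hi, h2⟩ := (hz (ρ g * σ)).eq_pow_of_pow_eq_one h1
    refine ⟨i, ?_⟩
    rw [ZMod.val_cast_of_lt hi, h2, div_mul_cancel₀ _ (hα0 _)]
  choose e he using hex
  have hinj {σ : L ≃ₐ[K] L} {i j : ZMod n} (h : z σ ^ i.val * α σ = z σ ^ j.val * α σ) : i = j :=
    ZMod.val_injective n ((hz σ).pow_inj (ZMod.val_lt i) (ZMod.val_lt j)
      (mul_right_cancel₀ (hα0 σ) h))
  have hcoc (g h : Ω ≃ₐ[K] Ω) (σ : L ≃ₐ[K] L) : e (g * h) σ = e g (ρ h * σ) + e h σ := by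
    apply hinj (σ := ρ g * (ρ h * σ))
    rw [pow_zmod_val_add (hz _).pow_eq_one, ← mul_assoc (ρ g), ← map_mul, ← he, AlgEquiv.mul_apply,
      he, map_mul, map_pow, hzg, he, map_mul, mul_assoc (ρ g)]
    ring
  refine ⟨e, hcoc, ?_, α, fun g hg hgα σ ↦ ?_⟩
  · let κ : ρ.ker →* Multiplicative ((L ≃ₐ[K] L) → ZMod n) :=
      MonoidHom.mk' (fun g ↦ Multiplicative.ofAdd (e g)) fun g h ↦ by
        rw [← ofAdd_add]
        congr 1
        ext σ
        simp [hcoc, MonoidHom.mem_ker.mp h.2]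
    suffices h : Multiplicative.ofAdd (Pi.single 1 1) ∈ κ.range by
      obtain ⟨x, hx⟩ := h
      have hx' : e x = Pi.single 1 1 := Multiplicative.ofAdd.injective hx
      exact ⟨x, x.2, by simp [hx'], fun σ hσ ↦ by simp [hx', hσ]⟩
    rw [← CommGroup.forall_monoidHom_apply_eq_one_iff (M := Ω)]
    intro φ hφ
    let χ (σ : L ≃ₐ[K] L) : Ωˣ := φ (Multiplicative.ofAdd (Pi.single σ 1))
    have hχn (σ : L ≃ₐ[K] L) : χ σ ^ n = 1 := by
      rw [← map_pow, ← ofAdd_nsmul, ← Pi.single_smul]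
      simp
    have hφχ (f : (L ≃ₐ[K] L) → ZMod n) :
        φ (Multiplicative.ofAdd f) = ∏ σ, χ σ ^ (f σ).val := by
      have h1 : f = ∑ σ, (f σ).val • (Pi.single σ 1 : (L ≃ₐ[K] L) → ZMod n) := by
        ext τ
        simp only [Finset.sum_apply, Pi.smul_apply, Pi.single_apply]
        simp
      conv_lhs => rw [h1]
      simp only [ofAdd_sum, map_prod, ofAdd_nsmul, map_pow, χ]
    have hm (σ : L ≃ₐ[K] L) : ∃ m : ℕ, z σ ^ m = χ σ := by
      obtain ⟨m, -, hm⟩ := (hz σ).eq_pow_of_pow_eq_one (ξ := (χ σ : Ω)) (by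
        rw [← Units.val_pow_eq_pow_val, hχn, Units.val_one])
      exact ⟨m, hm⟩
    choose m hm using hm
    have hB : (∏ σ, α σ ^ m σ) ∈ L := by
      refine (InfiniteGalois.fixedField_fixingSubgroup L).le ?_
      rw [← L.restrictNormalHom_ker]
      rintro ⟨x, hx⟩
      have hx1 : ρ x = 1 := hx
      have h1 := congrArg Units.val (hφ _ ⟨⟨x, hx⟩, rfl⟩)
      change ((φ (Multiplicative.ofAdd (e x)) : Ωˣ) : Ω) = 1 at h1
      rw [hφχ, Units.coe_prod] at h1
      change x _ = _
      calc x (∏ σ, α σ ^ m σ) = (∏ σ, ((χ σ ^ (e x σ).val : Ωˣ) : Ω)) * ∏ σ, α σ ^ m σ := by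
            rw [map_prod, ← Finset.prod_mul_distrib]
            refine Finset.prod_congr rfl fun σ _ ↦ ?_
            rw [map_pow, he, hx1, one_mul, mul_pow, Units.val_pow_eq_pow_val, ← hm, pow_right_comm]
        _ = _ := by rw [h1, one_mul]
    have hdvd : n ∣ m 1 := by
      refine NumberField.dvd_of_pow_eq_prod_conj (b := ⟨_, hB⟩) ha hσa ?_
      apply (algebraMap L Ω).injective
      simp only [map_pow, map_prod]
      change (∏ σ, α σ ^ m σ) ^ n = ∏ σ, ((σ a : L) : Ω) ^ m σ
      rw [← Finset.prod_pow]
      exact Finset.prod_congr rfl fun σ _ ↦ by rw [pow_right_comm, hα]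
    ext
    change ((χ 1 : Ωˣ) : Ω) = 1
    rw [← hm, (hz 1).pow_eq_one_iff_dvd]
    exact hdvd
  · apply hinj (σ := ρ g * σ)
    rw [← he, hg, one_mul, hgα, ZMod.val_zero, pow_zero, one_mul]

/-- Any element `t` of `T` can be added to the image of a continuous homomorphism by changing it
within its class modulo `T`. -/
theorem NumberField.exists_continuous_twist_mem_range (K : Type*) [Field K] [NumberField K]
    {G : Type*} [Group G] [Finite G] (T : Subgroup G) [T.Normal] [IsMulCommutative T]
    [TopologicalSpace G] [DiscreteTopology G]
    {π : (AlgebraicClosure K ≃ₐ[K] AlgebraicClosure K) →* G} (hπ : Continuous π)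
    {t : G} (ht : t ∈ T) :
    ∃ π' : (AlgebraicClosure K ≃ₐ[K] AlgebraicClosure K) →* G, Continuous π' ∧
      (∀ g, (π g)⁻¹ * π' g ∈ T) ∧ π.range ≤ π'.range ∧ t ∈ π'.range := by
  have : NeZero (orderOf t) := ⟨(orderOf_pos t).ne'⟩
  obtain ⟨ζ, hζ⟩ := HasEnoughRootsOfUnity.exists_primitiveRoot (AlgebraicClosure K) (orderOf t)
  have hopen : ((π.ker ⊓ MulAction.stabilizer _ ζ : Subgroup _) :
      Set (AlgebraicClosure K ≃ₐ[K] AlgebraicClosure K)) ∈ nhds 1 := by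
    refine IsOpen.mem_nhds (IsOpen.inter ?_ (stabilizer_isOpen_of_isIntegral ζ)) (one_mem _)
    exact (isOpen_discrete {1}).preimage hπ
  obtain ⟨L, hLfin, hLnormal, hL⟩ := (krullTopology_mem_nhds_one_iff_of_normal _ _ _).mp hopen
  have : NumberField L := NumberField.of_module_finite K L
  have hζL : ζ ∈ L := by
    rw [← InfiniteGalois.fixedField_fixingSubgroup L]
    exact fun g ↦ (hL g.2).2
  have hζ' : IsPrimitiveRoot (⟨ζ, hζL⟩ : L) (orderOf t) :=
    IsPrimitiveRoot.of_map_of_injective (f := algebraMap L (AlgebraicClosure K)) hζ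
      (algebraMap L _).injective
  obtain ⟨e, he, ⟨x, hx, hx1, hxσ⟩, α, hα⟩ := NumberField.exists_kummer_cocycle L hζ'
  obtain ⟨π', hT, hrange, htr, hker⟩ := MonoidHom.exists_twist_of_cocycle (T := T) (π := π)
    (AlgEquiv.restrictNormalHom_surjective (F := K) (K₁ := L) (AlgebraicClosure K))
    (by rw [L.restrictNormalHom_ker]; exact fun g hg ↦ (hL hg).1)
    ht (pow_orderOf_eq_one t) he hx hx1 hxσ
  refine ⟨π', ?_, hT, hrange, htr⟩
  refine continuous_of_continuousAt_one π' ?_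
  rw [ContinuousAt, map_one, nhds_discrete G, Filter.tendsto_pure]
  have h1 : (L.fixingSubgroup : Set (AlgebraicClosure K ≃ₐ[K] AlgebraicClosure K)) ∈ nhds 1 :=
    L.fixingSubgroup_isOpen.mem_nhds (one_mem _)
  have h2 : ∀ᶠ g in nhds (1 : AlgebraicClosure K ≃ₐ[K] AlgebraicClosure K),
      ∀ σ, g (α σ) = α σ :=
    Filter.eventually_all.mpr fun σ ↦
      (stabilizer_isOpen_of_isIntegral (α σ)).mem_nhds (one_mem _)
  filter_upwards [h1, h2] with g hg1 hg2
  have hg : AlgEquiv.restrictNormalHom L g = 1 := by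
    rwa [SetLike.mem_coe, ← L.restrictNormalHom_ker] at hg1
  exact hker g hg (hα g hg hg2)

/-- Let `K` be a number field with absolute Galois group
`Γ_K = Gal(K̄/K)` (with the Krull topology), `G` a finite (discrete) group and `T` an abelian
normal subgroup of `G`.  Suppose `π : Γ_K → G` is a continuous homomorphism whose image
satisfies `π(Γ_K)·T = G`.  Then there exists a continuous surjective homomorphism
`π′ : Γ_K → G` such that `π′(x)T = π(x)T` for all `x ∈ Γ_K`. -/
theorem statement9 (K : Type*) [Field K] [NumberField K] {G : Type*} [Group G] [Finite G]
    (T : Subgroup G) (hTnormal : T.Normal) (hTab : ∀ s ∈ T, ∀ t ∈ T, s * t = t * s)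
    (π : (AlgebraicClosure K ≃ₐ[K] AlgebraicClosure K) →* G)
    (hπcont : @Continuous _ G (krullTopology K (AlgebraicClosure K)) ⊥ ⇑π)
    (hπT : ∀ g : G, ∃ σ, ∃ t ∈ T, g = π σ * t) :
    ∃ π' : (AlgebraicClosure K ≃ₐ[K] AlgebraicClosure K) →* G,
      @Continuous _ G (krullTopology K (AlgebraicClosure K)) ⊥ ⇑π' ∧
      Function.Surjective ⇑π' ∧
      ∀ σ, (π σ)⁻¹ * π' σ ∈ T := by
  have := hTnormal
  have : IsMulCommutative T :=
    ⟨⟨fun s t ↦ Subtype.ext (hTab s s.2 t t.2)⟩⟩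
  let _ : TopologicalSpace G := ⊥
  have : DiscreteTopology G := ⟨rfl⟩
  have key (S : Set G) (hS : S ⊆ T) :
      ∃ π' : (AlgebraicClosure K ≃ₐ[K] AlgebraicClosure K) →* G, Continuous π' ∧
        (∀ g, (π g)⁻¹ * π' g ∈ T) ∧ S ⊆ π'.range := by
    induction S, S.toFinite using Set.Finite.induction_on with
    | empty => exact ⟨π, hπcont, fun g ↦ by simp, by simp⟩
    | @insert t S _ _ ih =>
      obtain ⟨π₁, hc₁, hT₁, hS₁⟩ := ih ((Set.subset_insert t S).trans hS)
      obtain ⟨π₂, hc₂, hT₂, hr₂, ht₂⟩ := NumberField.exists_continuous_twist_mem_range K T hc₁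
        (hS (Set.mem_insert t S))
      refine ⟨π₂, hc₂, fun g ↦ ?_, Set.insert_subset ht₂ (hS₁.trans hr₂)⟩
      simpa [mul_assoc] using T.mul_mem (hT₁ g) (hT₂ g)
  obtain ⟨π', hc, hT, hr⟩ := key T subset_rfl
  refine ⟨π', hc, fun g ↦ ?_, hT⟩
  obtain ⟨σ, t, ht, rfl⟩ := hπT g
  have hmem : ((π σ)⁻¹ * π' σ)⁻¹ * t ∈ π'.range := hr (T.mul_mem (T.inv_mem (hT σ)) ht)
  simpa [mul_assoc] using π'.range.mul_mem ⟨σ, rfl⟩ hmem
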